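/- For every integer n ≥ 0, every integer 0 ≤ k ≤ n, and every (x,y) ∈ B₂: y·Q_n^k(x,y) = c_{k,n}·Q_{n+1}^{k−1}(x,y) + d_{k,n}·Q_{n+1}^{k+1}(x,y) + d_{k−1,n−1}·Q_{n−1}^{k−1}(x,y) + c_{k+1,n−1}·Q_{n−1}^{k+1}(x,y), with the convention that any term Q_m^l with l < 0 or l > m is taken to be 0. -/

import Mathlib

open MeasureTheory Real Filter

/-- The Gegenbauer polynomials `C_n^λ`, defined by their triple recursion. -/
noncomputable def gegenbauer (lam : ℝ) : ℕ → ℝ → ℝ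
  | 0, _ => 1
  | 1, t => 2 * lam * t
  | (n + 2), t =>
      (2 * (((n : ℝ) + 1) + lam) / ((n : ℝ) + 2)) * t * gegenbauer lam (n + 1) t
        - ((((n : ℝ) + 1) + 2 * lam - 1) / ((n : ℝ) + 2)) * gegenbauer lam n t

/-- The open unit disk in `ℝ²`. -/
def unitDisk : Set (ℝ × ℝ) := {p | p.1 ^ 2 + p.2 ^ 2 < 1}

/-- The normalization constant `h_{k,n}`. -/
noncomputable def hConst (k n : ℕ) : ℝ :=
  Real.sqrt ((π / 4 ^ k) * (Nat.factorial (n + k + 1)) /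
    (((n : ℝ) + 1) * (2 * (k : ℝ) + 1) * ((Nat.factorial k : ℝ)) ^ 2 *
      (Nat.factorial (n - k) : ℝ)))

/-- The orthonormal polynomial basis `Q_n^k` on the unit disk. -/
noncomputable def Q2 (n k : ℕ) (x y : ℝ) : ℝ :=
  (1 / hConst k n) * gegenbauer ((k : ℝ) + 1) (n - k) x *
    (1 - x ^ 2) ^ ((k : ℝ) / 2) * gegenbauer (1 / 2) k (y / Real.sqrt (1 - x ^ 2))

/-- The recursion coefficient `a_{k,n}`. -/
noncomputable def aCoef (k n : ℤ) : ℝ :=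
  (1 / 2) * Real.sqrt (((n : ℝ) - k + 1) * ((n : ℝ) + k + 2) /
    (((n : ℝ) + 1) * ((n : ℝ) + 2)))

/-- The recursion coefficient `d_{k,n}`. -/
noncomputable def dCoef (k n : ℤ) : ℝ :=
  (((k : ℝ) + 1) / 2) * Real.sqrt (((n : ℝ) + k + 3) * ((n : ℝ) + k + 2) /
    ((2 * (k : ℝ) + 1) * (2 * (k : ℝ) + 3) * ((n : ℝ) + 1) * ((n : ℝ) + 2)))

/-- The recursion coefficient `c_{k,n}`. -/
noncomputable def cCoef (k n : ℤ) : ℝ :=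
  -((k : ℝ) / 2) * Real.sqrt (((n : ℝ) - k + 1) * ((n : ℝ) - k + 2) /
    (((n : ℝ) + 1) * ((n : ℝ) + 2) * (2 * (k : ℝ) - 1) * (2 * (k : ℝ) + 1)))

/-- `Q_m^l` extended by the convention that it vanishes when `l < 0` or `l > m`. -/
noncomputable def Q2ext (m l : ℤ) (x y : ℝ) : ℝ :=
  if 0 ≤ l ∧ l ≤ m then Q2 m.toNat l.toNat x y else 0

/-- Gegenbauer recursion with denominators cleared. -/
theorem gegenbauer_succ_succ (lam : ℝ) (m : ℕ) (t : ℝ) :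
    ((m : ℝ) + 2) * gegenbauer lam (m + 2) t =
      2 * ((m : ℝ) + 1 + lam) * t * gegenbauer lam (m + 1) t
        - ((m : ℝ) + 2 * lam) * gegenbauer lam m t := by
  have h : (m : ℝ) + 2 ≠ 0 := by positivity
  rw [gegenbauer]
  field_simp
  ring

/-- The two contiguous relations expressing `C^λ` through `C^(λ+1)`. -/
theorem gegenbauer_contiguous (lam : ℝ) (m : ℕ) (t : ℝ) :
    ((m : ℝ) + 2) * gegenbauer lam (m + 2) t =
        2 * lam * (t * gegenbauer (lam + 1) (m + 1) t - gegenbauer (lam + 1) m t) ∧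
      ((m : ℝ) + 1 + 2 * lam) * gegenbauer lam (m + 1) t =
        2 * lam * (gegenbauer (lam + 1) (m + 1) t - t * gegenbauer (lam + 1) m t) := by
  induction m with
  | zero => constructor <;> simp [gegenbauer] <;> ring
  | succ m ih =>
    obtain ⟨hF, hE⟩ := ih
    have hD := gegenbauer_succ_succ (lam + 1) m t
    have hC := gegenbauer_succ_succ lam (m + 1) t
    push_cast at hC ⊢
    have hE' : ((m : ℝ) + 1 + 1 + 2 * lam) * gegenbauer lam (m + 1 + 1) t =
        2 * lam * (gegenbauer (lam + 1) (m + 1 + 1) t - t * gegenbauer (lam + 1) (m + 1) t) := by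
      have h : (m : ℝ) + 2 ≠ 0 := by positivity
      apply mul_left_cancel₀ h
      linear_combination ((m : ℝ) + 2 + 2 * lam) * hF - 2 * lam * hD
    refine ⟨?_, hE'⟩
    linear_combination hC + t * hF + t * hE' - hE

/-- Raising the parameter: `(m+λ) C_m^λ = λ (C_m^(λ+1) - C_(m-2)^(λ+1))`. -/
theorem gegenbauer_eq_sub (lam : ℝ) (m : ℕ) (t : ℝ) :
    ((m : ℝ) + 2 + lam) * gegenbauer lam (m + 2) t =
      lam * (gegenbauer (lam + 1) (m + 2) t - gegenbauer (lam + 1) m t) := by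
  have hF := (gegenbauer_contiguous lam m t).1
  have hE := (gegenbauer_contiguous lam (m + 1) t).2
  push_cast at hE
  linear_combination hF / 2 + hE / 2

/-- Lowering the parameter after multiplication by `1 - t²`. -/
theorem one_sub_sq_mul_gegenbauer (lam : ℝ) (m : ℕ) (t : ℝ) :
    4 * lam * ((m : ℝ) + lam + 1) * (1 - t ^ 2) * gegenbauer (lam + 1) m t =
      ((m : ℝ) + 2 * lam) * ((m : ℝ) + 2 * lam + 1) * gegenbauer lam m t
        - ((m : ℝ) + 1) * ((m : ℝ) + 2) * gegenbauer lam (m + 2) t := by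
  cases m with
  | zero => simp [gegenbauer]; ring
  | succ m =>
    have hC := gegenbauer_succ_succ lam (m + 1) t
    obtain ⟨hF, hE⟩ := gegenbauer_contiguous lam m t
    push_cast at hC ⊢
    linear_combination ((m : ℝ) + 2) * hC - 2 * ((m : ℝ) + 2 + lam) * hE
      + 2 * ((m : ℝ) + 2 + lam) * t * hF

theorem hConst_pos (k n : ℕ) : 0 < hConst k n := by
  unfold hConst
  positivity

theorem hConst_sq (k m : ℕ) :
    hConst k (k + m) ^ 2 = (π / 4 ^ k) * (Nat.factorial (2 * k + m + 1)) /
      (((k : ℝ) + m + 1) * (2 * (k : ℝ) + 1) * ((Nat.factorial k : ℝ)) ^ 2 *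
        (Nat.factorial m : ℝ)) := by
  unfold hConst
  rw [Real.sq_sqrt (by positivity), Nat.add_sub_cancel_left,
    show k + m + k + 1 = 2 * k + m + 1 by ring]
  push_cast
  rfl

theorem hConst_sq_diag (k m : ℕ) :
    4 * ((k : ℝ) + m + 2) * (2 * (k : ℝ) + 3) * ((k : ℝ) + 1) ^ 2 *
        hConst (k + 1) (k + m + 1) ^ 2 =
      (2 * (k : ℝ) + m + 3) * (2 * (k : ℝ) + m + 2) * ((k : ℝ) + m + 1) * (2 * (k : ℝ) + 1) *
        hConst k (k + m) ^ 2 := by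
  rw [show k + m + 1 = (k + 1) + m by ring, hConst_sq, hConst_sq,
    show 2 * (k + 1) + m + 1 = 2 * k + m + 1 + 1 + 1 by ring,
    Nat.factorial_succ (2 * k + m + 1 + 1), Nat.factorial_succ (2 * k + m + 1),
    Nat.factorial_succ k]
  push_cast
  field_simp
  ring

theorem hConst_sq_antidiag (k m : ℕ) :
    4 * ((k : ℝ) + m + 2) * (2 * (k : ℝ) + 3) * ((k : ℝ) + 1) ^ 2 *
        hConst (k + 1) (k + 1 + m) ^ 2 =
      ((m : ℝ) + 1) * ((m : ℝ) + 2) * ((k : ℝ) + m + 3) * (2 * (k : ℝ) + 1) *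
        hConst k (k + (m + 2)) ^ 2 := by
  rw [hConst_sq, hConst_sq, show 2 * (k + 1) + m + 1 = 2 * k + (m + 2) + 1 by ring,
    Nat.factorial_succ (m + 1), Nat.factorial_succ m, Nat.factorial_succ k]
  push_cast
  field_simp
  ring

theorem dCoef_nonneg (k n : ℕ) : 0 ≤ dCoef k n := by
  unfold dCoef
  push_cast
  positivity

theorem dCoef_sq (k m : ℕ) :
    dCoef k ((k + m : ℕ) : ℤ) ^ 2 = (((k : ℝ) + 1) / 2) ^ 2 *
      ((2 * (k : ℝ) + m + 3) * (2 * (k : ℝ) + m + 2) /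
        ((2 * (k : ℝ) + 1) * (2 * (k : ℝ) + 3) * ((k : ℝ) + m + 1) * ((k : ℝ) + m + 2))) := by
  unfold dCoef
  push_cast
  rw [mul_pow, Real.sq_sqrt (by positivity)]
  ring

theorem cCoef_sq (k m : ℕ) :
    cCoef ((k + 1 : ℕ) : ℤ) ((k + 1 + m : ℕ) : ℤ) ^ 2 = (((k : ℝ) + 1) / 2) ^ 2 *
      (((m : ℝ) + 1) * ((m : ℝ) + 2) /
        (((k : ℝ) + m + 2) * ((k : ℝ) + m + 3) * (2 * (k : ℝ) + 1) * (2 * (k : ℝ) + 3))) := by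
  unfold cCoef
  push_cast
  rw [mul_pow, Real.sq_sqrt]
  · ring
  · have h1 : (k : ℝ) + 1 + m - (k + 1) + 1 = m + 1 := by ring
    have h2 : (k : ℝ) + 1 + m - (k + 1) + 2 = m + 2 := by ring
    have h3 : 2 * ((k : ℝ) + 1) - 1 = 2 * k + 1 := by ring
    rw [h1, h2, h3]
    positivity

theorem cCoef_nonpos (k n : ℕ) : cCoef k n ≤ 0 := by
  unfold cCoef
  have hk : (0 : ℝ) ≤ ((k : ℤ) : ℝ) / 2 := by push_cast; positivity
  exact mul_nonpos_of_nonpos_of_nonneg (neg_nonpos.mpr hk) (Real.sqrt_nonneg _)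

theorem dCoef_mul_hConst (k m : ℕ) :
    (2 * (k : ℝ) + 1) * ((k : ℝ) + m + 1) * dCoef k ((k + m : ℕ) : ℤ) * hConst k (k + m) =
      ((k : ℝ) + 1) ^ 2 * hConst (k + 1) (k + m + 1) := by
  have h0 := (hConst_pos k (k + m)).le
  have h1 := (hConst_pos (k + 1) (k + m + 1)).le
  have h2 := dCoef_nonneg k (k + m)
  rw [← sq_eq_sq₀ (by positivity) (by positivity)]
  simp only [mul_pow, dCoef_sq]
  have h := hConst_sq_diag k m
  field_simp
  linear_combination -h

theorem dCoef_mul_hConst_succ (k m : ℕ) :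
    4 * (2 * (k : ℝ) + 3) * ((k : ℝ) + m + 2) * dCoef k ((k + m : ℕ) : ℤ) *
        hConst (k + 1) (k + m + 1) =
      (2 * (k : ℝ) + m + 2) * (2 * (k : ℝ) + m + 3) * hConst k (k + m) := by
  have h0 := (hConst_pos k (k + m)).le
  have h1 := (hConst_pos (k + 1) (k + m + 1)).le
  have h2 := dCoef_nonneg k (k + m)
  rw [← sq_eq_sq₀ (by positivity) (by positivity)]
  simp only [mul_pow, dCoef_sq]
  have h := hConst_sq_diag k m
  field_simp
  linear_combination 4 * h

theorem cCoef_mul_hConst (k m : ℕ) :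
    (2 * (k : ℝ) + 1) * ((k : ℝ) + m + 3) * cCoef ((k + 1 : ℕ) : ℤ) ((k + 1 + m : ℕ) : ℤ) *
        hConst k (k + (m + 2)) =
      -(((k : ℝ) + 1) ^ 2 * hConst (k + 1) (k + 1 + m)) := by
  have h0 := (hConst_pos k (k + (m + 2))).le
  have h1 := (hConst_pos (k + 1) (k + 1 + m)).le
  have h2 := neg_nonneg.mpr (cCoef_nonpos (k + 1) (k + 1 + m))
  rw [← neg_inj, neg_neg, ← neg_mul, ← mul_neg, ← sq_eq_sq₀ (by positivity) (by positivity)]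
  simp only [mul_pow, neg_sq, cCoef_sq]
  have h := hConst_sq_antidiag k m
  field_simp
  linear_combination -h

theorem cCoef_mul_hConst_succ (k m : ℕ) :
    4 * (2 * (k : ℝ) + 3) * ((k : ℝ) + m + 2) * cCoef ((k + 1 : ℕ) : ℤ) ((k + 1 + m : ℕ) : ℤ) *
        hConst (k + 1) (k + 1 + m) =
      -(((m : ℝ) + 1) * ((m : ℝ) + 2) * hConst k (k + (m + 2))) := by
  have h0 := (hConst_pos k (k + (m + 2))).le
  have h1 := (hConst_pos (k + 1) (k + 1 + m)).le
  have h2 := neg_nonneg.mpr (cCoef_nonpos (k + 1) (k + 1 + m))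
  rw [← neg_inj, neg_neg, ← neg_mul, ← mul_neg, ← sq_eq_sq₀ (by positivity) (by positivity)]
  simp only [mul_pow, neg_sq, cCoef_sq]
  have h := hConst_sq_antidiag k m
  field_simp
  linear_combination 4 * h

/-- `Q_{k+m}^k` with the power of `1 - x²` written as a natural power of its square root. -/
theorem Q2_add (k m : ℕ) (x y : ℝ) (hx : 0 ≤ 1 - x ^ 2) :
    Q2 (k + m) k x y = gegenbauer ((k : ℝ) + 1) m x * √(1 - x ^ 2) ^ k *
      gegenbauer (1 / 2) k (y / √(1 - x ^ 2)) / hConst k (k + m) := by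
  have h : (1 - x ^ 2) ^ ((k : ℝ) / 2) = √(1 - x ^ 2) ^ k := by
    rw [Real.sqrt_eq_rpow, ← Real.rpow_mul_natCast hx]
    ring_nf
  rw [Q2, h, Nat.add_sub_cancel_left]
  ring

theorem Q2ext_natCast {n k : ℕ} (h : k ≤ n) (x y : ℝ) : Q2ext n k x y = Q2 n k x y := by
  simp [Q2ext, h]

theorem Q2ext_of_lt {n k : ℤ} (h : n < k) (x y : ℝ) : Q2ext n k x y = 0 :=
  if_neg fun h' => absurd h'.2 (not_le.mpr h)

theorem Q2ext_of_neg {n k : ℤ} (h : k < 0) (x y : ℝ) : Q2ext n k x y = 0 :=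
  if_neg fun h' => absurd h'.1 (not_le.mpr h)

/-- The part of `y Q_{k+m}^k` of order `k + 1` in the angular variable. -/
theorem Q2ext_raise (k m : ℕ) (x y : ℝ) (hx : 0 ≤ 1 - x ^ 2) :
    dCoef k ((k + m : ℕ) : ℤ) * Q2ext (((k + m : ℕ) : ℤ) + 1) ((k : ℤ) + 1) x y +
      cCoef ((k : ℤ) + 1) (((k + m : ℕ) : ℤ) - 1) *
        Q2ext (((k + m : ℕ) : ℤ) - 1) ((k : ℤ) + 1) x y =
      gegenbauer ((k : ℝ) + 1) m x * √(1 - x ^ 2) ^ (k + 1) * (((k : ℝ) + 1) *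
        gegenbauer (1 / 2) (k + 1) (y / √(1 - x ^ 2))) /
          ((2 * (k : ℝ) + 1) * hConst k (k + m)) := by
  have hH := (hConst_pos k (k + m)).ne'
  have hH' := (hConst_pos (k + 1) (k + m + 1)).ne'
  have hd : dCoef k ((k + m : ℕ) : ℤ) * Q2ext (((k + m : ℕ) : ℤ) + 1) ((k : ℤ) + 1) x y =
      ((k : ℝ) + 1) ^ 2 / ((2 * (k : ℝ) + 1) * ((k : ℝ) + m + 1) * hConst k (k + m)) *
        (gegenbauer ((k : ℝ) + 2) m x * √(1 - x ^ 2) ^ (k + 1) *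
          gegenbauer (1 / 2) (k + 1) (y / √(1 - x ^ 2))) := by
    have e : Q2ext (((k + m : ℕ) : ℤ) + 1) ((k : ℤ) + 1) x y = Q2 (k + 1 + m) (k + 1) x y := by
      rw [← Q2ext_natCast (by omega)]
      push_cast
      ring_nf
    rw [e, Q2_add _ _ _ _ hx, show k + 1 + m = k + m + 1 by ring]
    have h := dCoef_mul_hConst k m
    have h3 : ((k + 1 : ℕ) : ℝ) + 1 = (k : ℝ) + 2 := by push_cast; ring
    rw [h3]
    field_simp
    linear_combination (gegenbauer ((k : ℝ) + 2) m x * √(1 - x ^ 2) ^ (k + 1) *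
          gegenbauer (1 / 2) (k + 1) (y / √(1 - x ^ 2))) * h
  rw [hd]
  match m with
  | 0 =>
    rw [Q2ext_of_lt (by push_cast; omega)]
    simp [gegenbauer]
    field_simp
  | 1 =>
    rw [Q2ext_of_lt (by push_cast; omega)]
    simp [gegenbauer]
    field_simp
    ring
  | m + 2 =>
    have e : Q2ext (((k + (m + 2) : ℕ) : ℤ) - 1) ((k : ℤ) + 1) x y =
        Q2 (k + 1 + m) (k + 1) x y := by
      rw [← Q2ext_natCast (by omega)]
      push_cast
      ring_nf
    have e' : cCoef ((k : ℤ) + 1) (((k + (m + 2) : ℕ) : ℤ) - 1) =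
        cCoef ((k + 1 : ℕ) : ℤ) ((k + 1 + m : ℕ) : ℤ) := by
      push_cast
      ring_nf
    rw [e, e', Q2_add _ _ _ _ hx]
    have hH'' := (hConst_pos (k + 1) (k + 1 + m)).ne'
    have hc := cCoef_mul_hConst k m
    have hg := gegenbauer_eq_sub ((k : ℝ) + 1) m x
    have h3 : ((k + 1 : ℕ) : ℝ) + 1 = (k : ℝ) + 2 := by push_cast; ring
    have h4 : (k : ℝ) + 1 + 1 = (k : ℝ) + 2 := by ring
    have hc' : cCoef ((k + 1 : ℕ) : ℤ) ((k + 1 + m : ℕ) : ℤ) =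
        -(((k : ℝ) + 1) ^ 2 * hConst (k + 1) (k + 1 + m)) /
          ((2 * (k : ℝ) + 1) * ((k : ℝ) + m + 3) * hConst k (k + (m + 2))) := by
      rw [eq_div_iff (by positivity)]
      linear_combination hc
    rw [h4] at hg
    rw [h3, hc']
    push_cast
    field_simp
    linear_combination -(√(1 - x ^ 2) ^ (k + 1) *
      gegenbauer (1 / 2) (k + 1) (y / √(1 - x ^ 2)) * ((k : ℝ) + m + 3)) * hg

/-- The part of `y Q_{k+1+m}^{k+1}` of order `k` in the angular variable. -/
theorem Q2_lower (k m : ℕ) (x y : ℝ) (hx : 0 ≤ 1 - x ^ 2) :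
    cCoef ((k + 1 : ℕ) : ℤ) ((k + 1 + m : ℕ) : ℤ) * Q2 (k + (m + 2)) k x y +
      dCoef k ((k + m : ℕ) : ℤ) * Q2 (k + m) k x y =
      gegenbauer ((k : ℝ) + 2) m x * √(1 - x ^ 2) ^ (k + 2) * (((k : ℝ) + 1) *
        gegenbauer (1 / 2) k (y / √(1 - x ^ 2))) /
          ((2 * (k : ℝ) + 3) * hConst (k + 1) (k + 1 + m)) := by
  rw [Q2_add _ _ _ _ hx, Q2_add _ _ _ _ hx, pow_add _ k 2, Real.sq_sqrt hx]
  have hH := (hConst_pos k (k + m)).ne'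
  have hH' := (hConst_pos k (k + (m + 2))).ne'
  have hH'' := hConst_pos (k + 1) (k + 1 + m)
  have hc : cCoef ((k + 1 : ℕ) : ℤ) ((k + 1 + m : ℕ) : ℤ) =
      -(((m : ℝ) + 1) * ((m : ℝ) + 2) * hConst k (k + (m + 2))) /
        (4 * (2 * (k : ℝ) + 3) * ((k : ℝ) + m + 2) * hConst (k + 1) (k + 1 + m)) := by
    rw [eq_div_iff (by positivity)]
    linear_combination cCoef_mul_hConst_succ k m
  have hd : dCoef k ((k + m : ℕ) : ℤ) =
      (2 * (k : ℝ) + m + 2) * (2 * (k : ℝ) + m + 3) * hConst k (k + m) /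
        (4 * (2 * (k : ℝ) + 3) * ((k : ℝ) + m + 2) * hConst (k + 1) (k + 1 + m)) := by
    rw [eq_div_iff (by positivity), show k + 1 + m = k + m + 1 by ring]
    linear_combination dCoef_mul_hConst_succ k m
  have hg := one_sub_sq_mul_gegenbauer ((k : ℝ) + 1) m x
  have h4 : (k : ℝ) + 1 + 1 = (k : ℝ) + 2 := by ring
  rw [h4] at hg
  rw [hc, hd]
  field_simp
  linear_combination -(√(1 - x ^ 2) ^ k * gegenbauer (1 / 2) k (y / √(1 - x ^ 2))) * hg

/-- the `y`-direction triple recursion relation for the `Q_n^k`. -/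
theorem Q2_recursion_y (n k : ℕ) (hk : k ≤ n) (x y : ℝ)
    (hxy : (x, y) ∈ unitDisk) :
    y * Q2 n k x y =
      cCoef k n * Q2ext ((n : ℤ) + 1) ((k : ℤ) - 1) x y +
      dCoef k n * Q2ext ((n : ℤ) + 1) ((k : ℤ) + 1) x y +
      dCoef ((k : ℤ) - 1) ((n : ℤ) - 1) * Q2ext ((n : ℤ) - 1) ((k : ℤ) - 1) x y +
      cCoef ((k : ℤ) + 1) ((n : ℤ) - 1) * Q2ext ((n : ℤ) - 1) ((k : ℤ) + 1) x y := by
  have hx : 0 < 1 - x ^ 2 := by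
    have h : x ^ 2 + y ^ 2 < 1 := hxy
    nlinarith [sq_nonneg y]
  have hs : 0 < √(1 - x ^ 2) := Real.sqrt_pos.mpr hx
  obtain ⟨m, rfl⟩ := Nat.exists_eq_add_of_le hk
  have hr := Q2ext_raise k m x y hx.le
  cases k with
  | zero =>
    have hneg (l : ℤ) : Q2ext l (((0 : ℕ) : ℤ) - 1) x y = 0 := Q2ext_of_neg (by norm_num) x y
    rw [hneg, hneg, Q2_add _ _ _ _ hx.le, mul_zero, mul_zero,
      add_zero (_ + _), add_assoc, zero_add (_ * _ + _), hr]
    simp [gegenbauer]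
    field_simp
  | succ k =>
    have hH := (hConst_pos (k + 1) (k + 1 + m)).ne'
    have hl := Q2_lower k m x y hx.le
    have e1 : Q2ext (((k + 1 + m : ℕ) : ℤ) + 1) (((k + 1 : ℕ) : ℤ) - 1) x y =
        Q2 (k + (m + 2)) k x y := by
      rw [← Q2ext_natCast (by omega)]
      push_cast
      ring_nf
    have e2 : Q2ext (((k + 1 + m : ℕ) : ℤ) - 1) (((k + 1 : ℕ) : ℤ) - 1) x y =
        Q2 (k + m) k x y := by
      rw [← Q2ext_natCast (by omega)]
      push_cast
      ring_nf
    have e3 : dCoef (((k + 1 : ℕ) : ℤ) - 1) (((k + 1 + m : ℕ) : ℤ) - 1) =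
        dCoef k ((k + m : ℕ) : ℤ) := by
      push_cast
      ring_nf
    rw [e1, e2, e3, Q2_add _ _ _ _ hx.le]
    have hP := gegenbauer_succ_succ (1 / 2) k (y / √(1 - x ^ 2))
    have hy : y = √(1 - x ^ 2) * (y / √(1 - x ^ 2)) := by field_simp
    have h5 : ((k + 1 : ℕ) : ℝ) + 1 = (k : ℝ) + 2 := by push_cast; ring
    have h6 : 2 * ((k + 1 : ℕ) : ℝ) + 1 = 2 * (k : ℝ) + 3 := by push_cast; ring
    rw [h5, h6] at hr
    rw [h5]
    generalize y / √(1 - x ^ 2) = t at *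
    generalize √(1 - x ^ 2) = s at *
    suffices h : y * (gegenbauer ((k : ℝ) + 2) m x * s ^ (k + 1) *
        gegenbauer (1 / 2) (k + 1) t / hConst (k + 1) (k + 1 + m)) =
        gegenbauer ((k : ℝ) + 2) m x * s ^ (k + 2) * (((k : ℝ) + 1) * gegenbauer (1 / 2) k t) /
          ((2 * (k : ℝ) + 3) * hConst (k + 1) (k + 1 + m)) +
        gegenbauer ((k : ℝ) + 2) m x * s ^ (k + 1 + 1) * (((k : ℝ) + 2) *
          gegenbauer (1 / 2) (k + 1 + 1) t) /
          ((2 * (k : ℝ) + 3) * hConst (k + 1) (k + 1 + m)) by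
      linear_combination h - hl - hr
    rw [hy]
    field_simp
    linear_combination -(gegenbauer ((k : ℝ) + 2) m x * s ^ (k + 2)) * hP
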